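/- Let d be a positive integer, h, ρ > 0, 0 < μ < 1, and ε₁, ε₂ ≥ 0 with h·ε₁ ≤ (1 − μ)ρ. Let V : ℝᵈ → ℝ be differentiable, F, e : ℝᵈ → ℝᵈ, and α₃, α₄ : [0,∞) → ℝ with α₃(r) ≥ ρ·r + α₄(r) for all r ≥ 0. Suppose for all z ∈ ℝᵈ: DV(z)(F(z)) ≤ −α₃(‖z‖) and ‖DV(z)‖ ≤ h, where DV(z) : ℝᵈ → ℝ is the Fréchet derivative of V at z and ‖DV(z)‖ its operator norm. Then for every z ∈ ℝᵈ such that ‖e(z)‖ ≤ ε₁‖z‖ + ε₂ and ε₂ ≤ μ·(ρ/h)·‖z‖, one has DV(z)(F(z) + e(z)) ≤ −α₄(‖z‖). -/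

import Mathlib

/-- pointwise estimate (65)–(68) of Theorem 3.4: if
`DV(z)(F(z)) ≤ −α₃(‖z‖)`, `‖DV(z)‖ ≤ h`, `α₃(r) ≥ ρr + α₄(r)` for `r ≥ 0`,
`0 < μ < 1` and `hε₁ ≤ (1 − μ)ρ`, then for every `z` with `‖e(z)‖ ≤ ε₁‖z‖ + ε₂` and
`ε₂ ≤ μ(ρ/h)‖z‖` one has `DV(z)(F(z) + e(z)) ≤ −α₄(‖z‖)`. -/
theorem pointwise_estimate_thm34
    (d : ℕ) (hd : 0 < d) (h ρ μ ε₁ ε₂ : ℝ)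
    (hh : 0 < h) (hρ : 0 < ρ) (hμ₀ : 0 < μ) (hμ₁ : μ < 1)
    (hε₁ : 0 ≤ ε₁) (hε₂ : 0 ≤ ε₂) (hbound : h * ε₁ ≤ (1 - μ) * ρ)
    (V : EuclideanSpace ℝ (Fin d) → ℝ) (hV : Differentiable ℝ V)
    (F e : EuclideanSpace ℝ (Fin d) → EuclideanSpace ℝ (Fin d))
    (α₃ α₄ : ℝ → ℝ)
    (hα : ∀ r ≥ (0 : ℝ), α₃ r ≥ ρ * r + α₄ r)
    (hVF : ∀ z, fderiv ℝ V z (F z) ≤ -α₃ ‖z‖)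
    (hDV : ∀ z, ‖fderiv ℝ V z‖ ≤ h) :
    ∀ z, ‖e z‖ ≤ ε₁ * ‖z‖ + ε₂ → ε₂ ≤ μ * (ρ / h) * ‖z‖ →
      fderiv ℝ V z (F z + e z) ≤ -α₄ ‖z‖ := by
  intro z he h2
  have h1 : fderiv ℝ V z (e z) ≤ h * ‖e z‖ :=
    (le_abs_self _).trans ((fderiv ℝ V z).le_of_opNorm_le (hDV z) (e z))
  have h3 : h * ‖e z‖ ≤ h * (ε₁ * ‖z‖ + ε₂) := mul_le_mul_of_nonneg_left he hh.le
  have h4 : h * ε₂ ≤ h * (μ * (ρ / h) * ‖z‖) := mul_le_mul_of_nonneg_left h2 hh.le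
  have h5 : h * (μ * (ρ / h) * ‖z‖) = μ * ρ * ‖z‖ := by
    field_simp
  have h6 : h * ε₁ * ‖z‖ ≤ (1 - μ) * ρ * ‖z‖ :=
    mul_le_mul_of_nonneg_right hbound (norm_nonneg z)
  have h7 := hα ‖z‖ (norm_nonneg z)
  have h8 := hVF z
  rw [map_add]
  nlinarith
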